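/- Let a > b > 0 and b²/a < r < b. Then the area of the set {x ∈ ℝ² : (sphere(x,r) ∩ C(a,b)) has cardinality 4} equals −F(α), where F(φ) = 2r²φ + 2ab·arctan((b/a)tanφ) − 4ra·E(φ,ε) + raε² sin(2φ)/√(1−ε² sin²φ) and α = arctan( √(r²a² − b⁴) / (b√(b² − r²)) ). -/

import Mathlib

open Real MeasureTheory Set Metric

noncomputable section

/-- The Euclidean plane. -/
abbrev E2 := EuclideanSpace ℝ (Fin 2)

/-- Closed elliptical region with semi-axes `a`, `b`. -/
def Kset (a b : ℝ) : Set E2 := {x | (x 0)^2 / a^2 + (x 1)^2 / b^2 ≤ 1}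

/-- The ellipse with semi-axes `a`, `b`. -/
def Cset (a b : ℝ) : Set E2 := {x | (x 0)^2 / a^2 + (x 1)^2 / b^2 = 1}

/-- Incomplete elliptic integral of the second kind `E(φ, ε)`. -/
def Einc (ε φ : ℝ) : ℝ := ∫ θ in (0:ℝ)..φ, Real.sqrt (1 - ε^2 * Real.sin θ^2)

/-- Complete elliptic integral of the second kind `E(ε)`. -/
def Ecomp (ε : ℝ) : ℝ := Einc ε (π/2)

/-- Eccentricity of the ellipse with semi-axes `a ≥ b`. -/
def ecc (a b : ℝ) : ℝ := Real.sqrt (a^2 - b^2) / a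
/-- The antiderivative `F(φ)` from the paper's Lemma 1. -/
def Ffun (a b r φ : ℝ) : ℝ :=
  2*r^2*φ + 2*a*b*Real.arctan ((b/a)*Real.tan φ) - 4*r*a*Einc (ecc a b) φ
    + r*a*(ecc a b)^2 * Real.sin (2*φ) / Real.sqrt (1 - (ecc a b)^2 * Real.sin φ^2)
/-- The angle `α` from Case 2 of the paper's Lemma 1. -/
def alphaAng (a b r : ℝ) : ℝ :=
  Real.arctan (Real.sqrt (r^2*a^2 - b^4) / (b * Real.sqrt (b^2 - r^2)))

section LevelSets

/-- A set covered by three sets which it meets in at most one point each does not have four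
elements. -/
lemma ncard_ne_four_of_cover {S A B C : Set ℝ} (hS : S ⊆ A ∪ B ∪ C) (hA : (S ∩ A).Subsingleton)
    (hB : (S ∩ B).Subsingleton) (hC : (S ∩ C).Subsingleton) : S.ncard ≠ 4 := by
  have hle : ∀ T : Set ℝ, T.Subsingleton → T.ncard ≤ 1 := fun T hT => by
    rcases hT.eq_empty_or_singleton with h | ⟨x, h⟩ <;> simp [h]
  have hS' : S = (S ∩ A) ∪ (S ∩ B) ∪ (S ∩ C) := by
    rw [← inter_union_distrib_left, ← inter_union_distrib_left, inter_eq_left.2 hS]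
  have h1 := ncard_union_le ((S ∩ A) ∪ (S ∩ B)) (S ∩ C)
  have h2 := ncard_union_le (S ∩ A) (S ∩ B)
  have := hle _ hA
  have := hle _ hB
  have := hle _ hC
  rw [hS']
  omega

lemma subsingleton_level {f : ℝ → ℝ} {s D : Set ℝ} {v : ℝ} (hf : InjOn f s) :
    ({t ∈ D | f t = v} ∩ s).Subsingleton :=
  fun _ hx _ hy => hf hx.2 hy.2 (hx.1.2.trans hy.1.2.symm)

/-- A function which increases and then decreases takes no value four times. -/
lemma ncard_level_ne_four {f : ℝ → ℝ} {x₀ x₁ x₂ v : ℝ} (h01 : StrictMonoOn f (Icc x₀ x₁))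
    (h12 : StrictAntiOn f (Icc x₁ x₂)) : {t ∈ Ico x₀ x₂ | f t = v}.ncard ≠ 4 := by
  refine ncard_ne_four_of_cover (A := Icc x₀ x₁) (B := Icc x₁ x₂) (C := ∅) ?_
    (subsingleton_level h01.injOn) (subsingleton_level h12.injOn) (by simp)
  rintro t ⟨ht, -⟩
  rcases le_total t x₁ with h | h
  · exact Or.inl (Or.inl ⟨ht.1, h⟩)
  · exact Or.inl (Or.inr ⟨h, ht.2.le⟩)

/-- The values taken four times by a periodic function with two minima and two maxima per
period are those strictly between the larger minimum and the smaller maximum. -/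
lemma ncard_level_eq_four_iff {f : ℝ → ℝ} (hf : Continuous f) {x₀ x₁ x₂ x₃ x₄ v : ℝ}
    (l01 : x₀ < x₁) (l12 : x₁ < x₂) (l23 : x₂ < x₃) (l34 : x₃ < x₄)
    (h01 : StrictMonoOn f (Icc x₀ x₁)) (h12 : StrictAntiOn f (Icc x₁ x₂))
    (h23 : StrictMonoOn f (Icc x₂ x₃)) (h34 : StrictAntiOn f (Icc x₃ x₄))
    (h02 : f x₀ < f x₂) (h42 : f x₄ < f x₂) (h13 : f x₁ < f x₃) :
    {t ∈ Ico x₀ x₄ | f t = v}.ncard = 4 ↔ f x₂ < v ∧ v < f x₁ := by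
  constructor
  · intro h
    by_contra hcon
    rw [not_and_or, not_lt, not_lt] at hcon
    revert h
    rcases hcon with hv | hv
    · refine ncard_ne_four_of_cover (A := Icc x₀ x₁) (B := Icc x₁ x₃) (C := Icc x₃ x₄) ?_
        (subsingleton_level h01.injOn) ?_ (subsingleton_level h34.injOn)
      · rintro t ⟨ht, -⟩
        simp only [mem_union, mem_Icc]
        have := ht.1
        have := ht.2
        grind
      · have key : ∀ t ∈ Icc x₁ x₃, f t = v → t = x₂ := by
          intro t ht htv
          rcases lt_trichotomy t x₂ with h | h | h
          · have := h12 ⟨ht.1, h.le⟩ ⟨l12.le, le_rfl⟩ h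
            linarith
          · exact h
          · have := h23 ⟨le_rfl, l23.le⟩ ⟨h.le, ht.2⟩ h
            linarith
        rintro s ⟨hs, hs'⟩ t ⟨ht, ht'⟩
        rw [key s hs' hs.2, key t ht' ht.2]
    · refine ncard_ne_four_of_cover (A := Icc x₀ x₂) (B := Icc x₂ x₃) (C := Icc x₃ x₄) ?_
        ?_ (subsingleton_level h23.injOn) (subsingleton_level h34.injOn)
      · rintro t ⟨ht, -⟩
        simp only [mem_union, mem_Icc]
        have := ht.1
        have := ht.2
        grind
      · have key : ∀ t ∈ Icc x₀ x₂, f t = v → t = x₁ := by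
          intro t ht htv
          rcases lt_trichotomy t x₁ with h | h | h
          · have := h01 ⟨ht.1, h.le⟩ ⟨l01.le, le_rfl⟩ h
            linarith
          · exact h
          · have := h12 ⟨le_rfl, l12.le⟩ ⟨h.le, ht.2⟩ h
            linarith
        rintro s ⟨hs, hs'⟩ t ⟨ht, ht'⟩
        rw [key s hs' hs.2, key t ht' ht.2]
  · rintro ⟨hv2, hv1⟩
    obtain ⟨y₁, m₁, e₁⟩ := intermediate_value_Ioo l01.le hf.continuousOn
      (show v ∈ Ioo (f x₀) (f x₁) from ⟨h02.trans hv2, hv1⟩)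
    obtain ⟨y₂, m₂, e₂⟩ := intermediate_value_Ioo' l12.le hf.continuousOn
      (show v ∈ Ioo (f x₂) (f x₁) from ⟨hv2, hv1⟩)
    obtain ⟨y₃, m₃, e₃⟩ := intermediate_value_Ioo l23.le hf.continuousOn
      (show v ∈ Ioo (f x₂) (f x₃) from ⟨hv2, hv1.trans h13⟩)
    obtain ⟨y₄, m₄, e₄⟩ := intermediate_value_Ioo' l34.le hf.continuousOn
      (show v ∈ Ioo (f x₄) (f x₃) from ⟨h42.trans hv2, hv1.trans h13⟩)
    have hset : {t ∈ Ico x₀ x₄ | f t = v} = {y₁, y₂, y₃, y₄} := by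
      ext t
      simp only [mem_ofPred_eq, mem_insert_iff, mem_singleton_iff]
      constructor
      · rintro ⟨⟨ht0, ht4⟩, htv⟩
        rcases le_total t x₁ with h1 | h1
        · exact Or.inl (h01.injOn ⟨ht0, h1⟩ (Ioo_subset_Icc_self m₁) (htv.trans e₁.symm))
        rcases le_total t x₂ with h2 | h2
        · exact Or.inr (Or.inl
            (h12.injOn ⟨h1, h2⟩ (Ioo_subset_Icc_self m₂) (htv.trans e₂.symm)))
        rcases le_total t x₃ with h3 | h3
        · exact Or.inr (Or.inr (Or.inl
            (h23.injOn ⟨h2, h3⟩ (Ioo_subset_Icc_self m₃) (htv.trans e₃.symm))))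
        · exact Or.inr (Or.inr (Or.inr
            (h34.injOn ⟨h3, ht4.le⟩ (Ioo_subset_Icc_self m₄) (htv.trans e₄.symm))))
      · obtain ⟨a1, b1⟩ := m₁
        obtain ⟨a2, b2⟩ := m₂
        obtain ⟨a3, b3⟩ := m₃
        obtain ⟨a4, b4⟩ := m₄
        rintro (rfl | rfl | rfl | rfl)
        · exact ⟨⟨a1.le, by linarith⟩, e₁⟩
        · exact ⟨⟨by linarith, by linarith⟩, e₂⟩
        · exact ⟨⟨by linarith, by linarith⟩, e₃⟩
        · exact ⟨⟨by linarith, by linarith⟩, e₄⟩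
    have n12 : y₁ < y₂ := m₁.2.trans m₂.1
    have n23 : y₂ < y₃ := m₂.2.trans m₃.1
    have n34 : y₃ < y₄ := m₃.2.trans m₄.1
    rw [hset, ncard_insert_of_notMem, ncard_insert_of_notMem, ncard_pair n34.ne]
    · simp only [mem_insert_iff, mem_singleton_iff, not_or]
      exact ⟨n23.ne, (n23.trans n34).ne⟩
    · simp only [mem_insert_iff, mem_singleton_iff, not_or]
      exact ⟨n12.ne, (n12.trans n23).ne, (n12.trans (n23.trans n34)).ne⟩

end LevelSets

section CriticalPoints

/-- Half the derivative, at the eccentric angle `t`, of the squared distance from a point of the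
plane to the ellipse, where `c`, `P`, `Q` are `a² - b²`, `a p`, `b q` for the point `(p, -q)`. -/
def halfDeriv (c P Q t : ℝ) : ℝ := -c * sin t * cos t + P * sin t + Q * cos t

/-- `halfDeriv` divided by `sin t * cos t`. -/
def critFun (c P Q t : ℝ) : ℝ := -c + P / cos t + Q / sin t

/-- The derivative of `critFun`. -/
def critDeriv (P Q t : ℝ) : ℝ := P * sin t / cos t ^ 2 - Q * cos t / sin t ^ 2

lemma sin_cos_pos {t : ℝ} (ht : t ∈ Ioo 0 (π / 2)) : 0 < sin t ∧ 0 < cos t :=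
  ⟨sin_pos_of_pos_of_lt_pi ht.1 (by linarith [ht.2, pi_pos]),
    cos_pos_of_mem_Ioo ⟨by linarith [ht.1, pi_pos], ht.2⟩⟩

lemma continuous_halfDeriv (c P Q : ℝ) : Continuous (halfDeriv c P Q) := by
  unfold halfDeriv
  fun_prop

lemma halfDeriv_eq {c P Q t : ℝ} (ht : t ∈ Ioo 0 (π / 2)) :
    halfDeriv c P Q t = sin t * cos t * critFun c P Q t := by
  obtain ⟨hs, hc⟩ := sin_cos_pos ht
  unfold halfDeriv critFun
  field_simp

lemma hasDerivAt_critFun (c P Q : ℝ) {t : ℝ} (ht : t ∈ Ioo 0 (π / 2)) :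
    HasDerivAt (critFun c P Q) (critDeriv P Q t) t := by
  obtain ⟨hs, hc⟩ := sin_cos_pos ht
  have h1 := ((hasDerivAt_const t P).div (hasDerivAt_cos t) hc.ne').const_add (-c)
  have h2 := h1.add ((hasDerivAt_const t Q).div (hasDerivAt_sin t) hs.ne')
  refine h2.congr_deriv ?_
  unfold critDeriv
  ring

lemma strictConvexOn_critFun (c : ℝ) {P Q : ℝ} (hP : 0 < P) (hQ : 0 < Q) :
    StrictConvexOn ℝ (Ioo 0 (π / 2)) (critFun c P Q) := by
  refine StrictMonoOn.strictConvexOn_of_deriv (convex_Ioo _ _)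
    (fun t ht => (hasDerivAt_critFun c P Q ht).continuousAt.continuousWithinAt) ?_
  rw [interior_Ioo]
  intro s hs t ht hst
  rw [(hasDerivAt_critFun c P Q hs).deriv, (hasDerivAt_critFun c P Q ht).deriv]
  obtain ⟨s1, c1⟩ := sin_cos_pos hs
  obtain ⟨s2, c2⟩ := sin_cos_pos ht
  have hsin : sin s < sin t := sin_lt_sin_of_lt_of_le_pi_div_two (by linarith [hs.1, pi_pos])
    ht.2.le hst
  have hcos : cos t < cos s := cos_lt_cos_of_nonneg_of_le_pi_div_two hs.1.le ht.2.le hst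
  unfold critDeriv
  have e1 : P * sin s / cos s ^ 2 < P * sin t / cos t ^ 2 := by gcongr
  have e2 : Q * cos t / sin t ^ 2 < Q * cos s / sin s ^ 2 := by gcongr
  linarith

/-- On a quarter period the derivative of the squared distance either is never negative, vanishing
at most once, or it has exactly two zeros and is negative exactly between them. -/
lemma critFun_dichotomy (c : ℝ) {P Q : ℝ} (hP : 0 < P) (hQ : 0 < Q) :
    (∃ τ₁ τ₂, τ₁ ∈ Ioo 0 (π / 2) ∧ τ₂ ∈ Ioo 0 (π / 2) ∧ τ₁ < τ₂ ∧
      critFun c P Q τ₁ = 0 ∧ critFun c P Q τ₂ = 0 ∧ critDeriv P Q τ₁ < 0 ∧ 0 < critDeriv P Q τ₂ ∧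
      (∀ t ∈ Ioo 0 τ₁, 0 < critFun c P Q t) ∧ (∀ t ∈ Ioo τ₁ τ₂, critFun c P Q t < 0) ∧
      ∀ t ∈ Ioo τ₂ (π / 2), 0 < critFun c P Q t) ∨
    ∃ τ ∈ Ioo 0 (π / 2), (∀ t ∈ Ioo 0 (π / 2), t ≠ τ → 0 < critFun c P Q t) ∧
      (critFun c P Q τ = 0 → critDeriv P Q τ = 0) := by
  have hconv := strictConvexOn_critFun c hP hQ
  have quasi : ∀ x y z, x ∈ Ioo 0 (π / 2) → z ∈ Ioo 0 (π / 2) → x < y → y < z →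
      critFun c P Q y < max (critFun c P Q x) (critFun c P Q z) := by
    intro x y z hx hz hxy hyz
    exact hconv.lt_on_openSegment hx hz (hxy.trans hyz).ne (by
      rw [openSegment_eq_Ioo (hxy.trans hyz)]; exact ⟨hxy, hyz⟩)
  by_cases hneg : ∃ u ∈ Ioo 0 (π / 2), critFun c P Q u < 0
  · left
    obtain ⟨u, hu, hku⟩ := hneg
    have hDu : halfDeriv c P Q u < 0 := by
      rw [halfDeriv_eq hu]
      obtain ⟨s1, c1⟩ := sin_cos_pos hu
      exact mul_neg_of_pos_of_neg (by positivity) hku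
    have hD0 : 0 < halfDeriv c P Q 0 := by simpa [halfDeriv] using hQ
    have hD1 : 0 < halfDeriv c P Q (π / 2) := by simpa [halfDeriv] using hP
    obtain ⟨τ₁, m1, e1⟩ := intermediate_value_Ioo' hu.1.le
      (continuous_halfDeriv c P Q).continuousOn
      (show (0 : ℝ) ∈ Ioo (halfDeriv c P Q u) (halfDeriv c P Q 0) from ⟨hDu, hD0⟩)
    obtain ⟨τ₂, m2, e2⟩ := intermediate_value_Ioo hu.2.le
      (continuous_halfDeriv c P Q).continuousOn
      (show (0 : ℝ) ∈ Ioo (halfDeriv c P Q u) (halfDeriv c P Q (π / 2)) from ⟨hDu, hD1⟩)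
    have n1 : τ₁ ∈ Ioo 0 (π / 2) := ⟨m1.1, m1.2.trans hu.2⟩
    have n2 : τ₂ ∈ Ioo 0 (π / 2) := ⟨hu.1.trans m2.1, m2.2⟩
    have zero : ∀ t ∈ Ioo 0 (π / 2), halfDeriv c P Q t = 0 → critFun c P Q t = 0 := by
      intro t ht h
      rw [halfDeriv_eq ht] at h
      obtain ⟨s1, c1⟩ := sin_cos_pos ht
      exact (mul_eq_zero.1 h).resolve_left (by positivity)
    have k1 := zero τ₁ n1 e1
    have k2 := zero τ₂ n2 e2
    refine ⟨τ₁, τ₂, n1, n2, m1.2.trans m2.1, k1, k2, ?_, ?_, ?_, ?_, ?_⟩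
    · have := hconv.lt_slope_of_hasDerivAt n1 hu m1.2 (hasDerivAt_critFun c P Q n1)
      refine this.trans ?_
      rw [slope_def_field, k1, sub_zero]
      exact div_neg_of_neg_of_pos hku (by linarith [m1.2])
    · have := hconv.slope_lt_of_hasDerivAt hu n2 m2.1 (hasDerivAt_critFun c P Q n2)
      refine lt_trans ?_ this
      rw [slope_def_field, k2]
      exact div_pos (by linarith) (by linarith [m2.1])
    · intro t ht
      by_contra! h
      have := quasi t τ₁ u ⟨ht.1, ht.2.trans n1.2⟩ hu ht.2 m1.2
      rw [k1] at this
      exact absurd this (not_lt.2 (max_le h hku.le))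
    · intro t ht
      have := quasi τ₁ t τ₂ n1 n2 ht.1 ht.2
      rwa [k1, k2, max_self] at this
    · intro t ht
      by_contra! h
      have := quasi u τ₂ t hu ⟨n2.1.trans ht.1, ht.2⟩ m2.1 ht.1
      rw [k2] at this
      exact absurd this (not_lt.2 (max_le hku.le h))
  · right
    push Not at hneg
    by_cases hz : ∃ τ ∈ Ioo 0 (π / 2), critFun c P Q τ = 0
    · obtain ⟨τ, hτ, h0⟩ := hz
      refine ⟨τ, hτ, fun t ht hne => ?_, fun _ => ?_⟩
      · refine lt_of_le_of_ne (hneg t ht) fun h => ?_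
        have hmid : ∀ x y, x ∈ Ioo 0 (π / 2) → y ∈ Ioo 0 (π / 2) → x < y →
            critFun c P Q x = 0 → critFun c P Q y = 0 → False := by
          intro x y hx hy hxy ex ey
          have := quasi x ((x + y) / 2) y hx hy (by linarith) (by linarith)
          rw [ex, ey, max_self] at this
          exact absurd this (not_lt.2 (hneg _ ⟨by linarith [hx.1], by linarith [hy.2]⟩))
        rcases lt_or_gt_of_ne hne with h' | h'
        · exact hmid t τ ht hτ h' h.symm h0
        · exact hmid τ t hτ ht h' h0 h.symm
      · refine IsLocalMin.hasDerivAt_eq_zero ?_ (hasDerivAt_critFun c P Q hτ)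
        filter_upwards [Ioo_mem_nhds hτ.1 hτ.2] with t ht
        rw [h0]
        exact hneg t ht
    · push Not at hz
      have hm : π / 4 ∈ Ioo 0 (π / 2) := ⟨by positivity, by linarith [pi_pos]⟩
      exact ⟨π / 4, hm, fun t ht _ => lt_of_le_of_ne (hneg t ht) (hz t ht).symm,
        fun h => absurd h (hz _ hm)⟩

/-- The derivative of the squared distance changes sign exactly once on an adjacent quarter
period. -/
lemma exists_sign_change {c P Q : ℝ} (hc : 0 < c) (hP : 0 < P) (hQ : 0 < Q) :
    ∃ z ∈ Ioo 0 (π / 2), (∀ u ∈ Ico 0 z, 0 < c * sin u * cos u - P * sin u + Q * cos u) ∧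
      ∀ u ∈ Ioc z (π / 2), c * sin u * cos u - P * sin u + Q * cos u < 0 := by
  have hcont : Continuous fun u => c * sin u * cos u - P * sin u + Q * cos u := by fun_prop
  have h0 : (0 : ℝ) ∈ Ioo (c * sin (π / 2) * cos (π / 2) - P * sin (π / 2) + Q * cos (π / 2))
      (c * sin 0 * cos 0 - P * sin 0 + Q * cos 0) := by simp [hP, hQ]
  obtain ⟨z, hz, ez⟩ := intermediate_value_Ioo' pi_div_two_pos.le hcont.continuousOn h0
  simp only at ez
  obtain ⟨s1, c1⟩ := sin_cos_pos hz
  have ez' : P * sin z = cos z * (c * sin z + Q) := by linarith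
  refine ⟨z, hz, fun u hu => ?_, fun u hu => ?_⟩
  · rcases hu.1.eq_or_lt with rfl | hu0
    · simpa using hQ
    obtain ⟨s2, c2⟩ := sin_cos_pos (t := u) ⟨hu0, hu.2.trans hz.2⟩
    have hsin : sin u < sin z := sin_lt_sin_of_lt_of_le_pi_div_two (by linarith [pi_pos])
      hz.2.le hu.2
    have hcos : cos z < cos u := cos_lt_cos_of_nonneg_of_le_pi_div_two hu.1 hz.2.le hu.2
    have e1 : c * sin u * sin z * cos z < c * sin u * sin z * cos u := by gcongr
    have e2 : Q * (sin u * cos z) < Q * (sin z * cos u) := by gcongr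
    have : 0 < sin z * (c * sin u * cos u - P * sin u + Q * cos u) := by
      linear_combination e1 + e2 + sin u * ez'
    exact pos_of_mul_pos_right this s1.le
  · have s2 : 0 < sin u := sin_pos_of_pos_of_lt_pi (hz.1.trans hu.1) (by linarith [hu.2, pi_pos])
    have c2 : 0 ≤ cos u := cos_nonneg_of_mem_Icc ⟨by linarith [hz.1, hu.1, pi_pos], hu.2⟩
    have hsin : sin z < sin u := sin_lt_sin_of_lt_of_le_pi_div_two (by linarith [pi_pos, hz.1])
      hu.2 hu.1
    have hcos : cos u < cos z := cos_lt_cos_of_nonneg_of_le_pi_div_two hz.1.le hu.2 hu.1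
    have e1 : c * sin u * sin z * cos u < c * sin u * sin z * cos z := by gcongr
    have e2 : Q * (sin z * cos u) < Q * (sin u * cos z) := by gcongr
    have : sin z * (c * sin u * cos u - P * sin u + Q * cos u) < 0 := by
      linear_combination e1 + e2 - sin u * ez'
    exact neg_of_mul_neg_right this s1.le

end CriticalPoints

section Counting

/-- Squared distance from `(p, -q)` to the point of the ellipse with eccentric angle `t`. -/
def distSq (a b p q t : ℝ) : ℝ := (a * cos t - p) ^ 2 + (b * sin t + q) ^ 2

lemma hasDerivAt_distSq (a b p q t : ℝ) :
    HasDerivAt (distSq a b p q) (2 * halfDeriv (a ^ 2 - b ^ 2) (a * p) (b * q) t) t := by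
  have h1 := (((hasDerivAt_cos t).const_mul a).sub_const p).pow 2
  have h2 := (((hasDerivAt_sin t).const_mul b).add_const q).pow 2
  refine (h1.add h2).congr_deriv ?_
  unfold halfDeriv
  push_cast
  ring

lemma continuous_distSq (a b p q : ℝ) : Continuous (distSq a b p q) := by
  unfold distSq
  fun_prop

lemma strictMonoOn_distSq {a b p q x y : ℝ}
    (h : ∀ t ∈ Ioo x y, 0 < halfDeriv (a ^ 2 - b ^ 2) (a * p) (b * q) t) :
    StrictMonoOn (distSq a b p q) (Icc x y) := by
  refine strictMonoOn_of_deriv_pos (convex_Icc x y) (continuous_distSq a b p q).continuousOn ?_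
  intro t ht
  rw [interior_Icc] at ht
  rw [(hasDerivAt_distSq a b p q t).deriv]
  linarith [h t ht]

lemma strictAntiOn_distSq {a b p q x y : ℝ}
    (h : ∀ t ∈ Ioo x y, halfDeriv (a ^ 2 - b ^ 2) (a * p) (b * q) t < 0) :
    StrictAntiOn (distSq a b p q) (Icc x y) := by
  refine strictAntiOn_of_deriv_neg (convex_Icc x y) (continuous_distSq a b p q).continuousOn ?_
  intro t ht
  rw [interior_Icc] at ht
  rw [(hasDerivAt_distSq a b p q t).deriv]
  linarith [h t ht]

/-- The sign of `halfDeriv` outside the first quadrant. -/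
lemma halfDeriv_signs {c P Q : ℝ} (hc : 0 < c) (hP : 0 < P) (hQ : 0 < Q) :
    ∃ z ∈ Ioo 0 (π / 2), ∃ w ∈ Ioo 0 (π / 2),
      (∀ t ∈ Ioc (-z) 0, 0 < halfDeriv c P Q t) ∧
      (∀ t ∈ Ico (π / 2) (π / 2 + w), 0 < halfDeriv c P Q t) ∧
      ∀ t ∈ Ioo (π / 2 + w) (-z + 2 * π), halfDeriv c P Q t < 0 := by
  obtain ⟨z, hz, hz1, hz2⟩ := exists_sign_change hc hP hQ
  obtain ⟨w, hw, hw1, hw2⟩ := exists_sign_change hc hQ hP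
  refine ⟨z, hz, w, hw, fun t ht => ?_, fun t ht => ?_, fun t ht => ?_⟩
  · have := hz1 (-t) ⟨by linarith [ht.2], by linarith [ht.1]⟩
    rw [sin_neg, cos_neg] at this
    unfold halfDeriv
    linarith
  · have := hw1 (t - π / 2) ⟨by linarith [ht.1], by linarith [ht.2]⟩
    rw [sin_sub_pi_div_two, cos_sub_pi_div_two] at this
    unfold halfDeriv
    linarith
  · rcases le_total t π with h1 | h1
    · have := hw2 (t - π / 2) ⟨by linarith [ht.1], by linarith⟩
      rw [sin_sub_pi_div_two, cos_sub_pi_div_two] at this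
      unfold halfDeriv
      linarith
    rcases le_total t (3 * π / 2) with h2 | h2
    · have hs : sin (t - π) = - sin t := sin_sub_pi t
      have hk : cos (t - π) = - cos t := cos_sub_pi t
      have s0 : 0 ≤ sin (t - π) :=
        sin_nonneg_of_nonneg_of_le_pi (by linarith) (by linarith [pi_pos])
      have c0 : 0 ≤ cos (t - π) := cos_nonneg_of_mem_Icc ⟨by linarith [pi_pos], by linarith⟩
      have key : halfDeriv c P Q t = -(c * sin (t - π) * cos (t - π) + P * sin (t - π)
          + Q * cos (t - π)) := by
        rw [hs, hk]
        unfold halfDeriv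
        ring
      rw [key, neg_lt_zero]
      rcases s0.eq_or_lt with h | h
      · have h1 := sin_sq_add_cos_sq (t - π)
        have : 0 < cos (t - π) := lt_of_le_of_ne c0 fun h' => by
          rw [← h, ← h'] at h1
          norm_num at h1
        positivity
      · positivity
    · have := hz2 (2 * π - t) ⟨by linarith [ht.2], by linarith⟩
      rw [sin_two_pi_sub, cos_two_pi_sub] at this
      unfold halfDeriv
      linarith

lemma strictAntiOn_distSq_of_critFun_neg {a b p q τ₁ τ₂ : ℝ} (h₁ : 0 < τ₁) (h₂ : τ₂ < π / 2)
    (h : ∀ t ∈ Ioo τ₁ τ₂, critFun (a ^ 2 - b ^ 2) (a * p) (b * q) t < 0) :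
    StrictAntiOn (distSq a b p q) (Icc τ₁ τ₂) := by
  refine strictAntiOn_distSq fun t ht => ?_
  have ht' : t ∈ Ioo 0 (π / 2) := ⟨h₁.trans ht.1, ht.2.trans h₂⟩
  rw [halfDeriv_eq ht']
  obtain ⟨s1, c1⟩ := sin_cos_pos ht'
  exact mul_neg_of_pos_of_neg (by positivity) (h t ht)

/-- A local maximum of the squared distance is accompanied by a lower local minimum. -/
lemma exists_lower_min {a b p q t : ℝ} (hP : 0 < a * p) (hQ : 0 < b * q) (ht : t ∈ Ioo 0 (π / 2))
    (h0 : critFun (a ^ 2 - b ^ 2) (a * p) (b * q) t = 0) (hd : critDeriv (a * p) (b * q) t < 0) :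
    ∃ u ∈ Ioo 0 (π / 2), critFun (a ^ 2 - b ^ 2) (a * p) (b * q) u = 0 ∧
      0 < critDeriv (a * p) (b * q) u ∧ distSq a b p q u < distSq a b p q t := by
  rcases critFun_dichotomy (a ^ 2 - b ^ 2) hP hQ with
    ⟨τ₁, τ₂, m1, m2, l12, k1, k2, d1, d2, s1, s2, s3⟩ | ⟨τ, hτ, hτ1, hτ2⟩
  · refine ⟨τ₂, m2, k2, d2, ?_⟩
    have h12 := strictAntiOn_distSq_of_critFun_neg m1.1 m2.2 s2
    rcases lt_trichotomy t τ₁ with h | rfl | h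
    · exact absurd h0 (s1 t ⟨ht.1, h⟩).ne'
    · exact h12 ⟨le_rfl, l12.le⟩ ⟨l12.le, le_rfl⟩ l12
    rcases lt_trichotomy t τ₂ with h' | rfl | h'
    · exact absurd h0 (s2 t ⟨h, h'⟩).ne
    · linarith
    · exact absurd h0 (s3 t ⟨h', ht.2⟩).ne'
  · by_cases h : t = τ
    · subst h
      exact absurd (hτ2 h0) hd.ne
    · exact absurd h0 (hτ1 t ht h).ne'

lemma ncard_distSq_level_eq_four_iff {a b p q : ℝ} (v : ℝ) (hb : 0 < b) (hba : b < a) (hp : 0 < p)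
    (hq : 0 < q) :
    ∃ θ, ({t ∈ Ico θ (θ + 2 * π) | distSq a b p q t = v}.ncard = 4 ↔
      (∃ t ∈ Ioo 0 (π / 2), critFun (a ^ 2 - b ^ 2) (a * p) (b * q) t = 0 ∧
        0 < critDeriv (a * p) (b * q) t ∧ distSq a b p q t < v) ∧
      ¬ ∃ t ∈ Ioo 0 (π / 2), critFun (a ^ 2 - b ^ 2) (a * p) (b * q) t = 0 ∧
        critDeriv (a * p) (b * q) t < 0 ∧ distSq a b p q t ≤ v) := by
  have hc : 0 < a ^ 2 - b ^ 2 := by nlinarith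
  have hP : 0 < a * p := mul_pos (hb.trans hba) hp
  have hQ : 0 < b * q := mul_pos hb hq
  obtain ⟨z, hz, w, hw, sz, sw, sn⟩ := halfDeriv_signs hc hP hQ
  have hpos : ∀ t ∈ Ioo 0 (π / 2), 0 < critFun (a ^ 2 - b ^ 2) (a * p) (b * q) t →
      0 < halfDeriv (a ^ 2 - b ^ 2) (a * p) (b * q) t := by
    intro t ht h
    rw [halfDeriv_eq ht]
    obtain ⟨s1, c1⟩ := sin_cos_pos ht
    positivity
  have h34 := strictAntiOn_distSq sn
  have hz1 := hz.1
  have hz2 := hz.2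
  have hw1 := hw.1
  have hw2 := hw.2
  refine ⟨-z, ?_⟩
  rcases critFun_dichotomy (a ^ 2 - b ^ 2) hP hQ with
    ⟨τ₁, τ₂, m1, m2, l12, k1, k2, d1, d2, s1, s2, s3⟩ | ⟨τ, hτ, hτ1, hτ2⟩
  · have m11 := m1.1
    have m12 := m1.2
    have m21 := m2.1
    have m22 := m2.2
    have h01 : StrictMonoOn (distSq a b p q) (Icc (-z) τ₁) := by
      refine strictMonoOn_distSq fun t ht => ?_
      rcases le_or_gt t 0 with h | h
      · exact sz t ⟨ht.1, h⟩
      · exact hpos t ⟨h, ht.2.trans m12⟩ (s1 t ⟨h, ht.2⟩)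
    have h12 := strictAntiOn_distSq_of_critFun_neg m11 m22 s2
    have h23 : StrictMonoOn (distSq a b p q) (Icc τ₂ (π / 2 + w)) := by
      refine strictMonoOn_distSq fun t ht => ?_
      rcases lt_or_ge t (π / 2) with h | h
      · exact hpos t ⟨m21.trans ht.1, h⟩ (s3 t ⟨ht.1, h⟩)
      · exact sw t ⟨h, ht.2⟩
    have hper : distSq a b p q (-z + 2 * π) = distSq a b p q (-z) := by
      unfold distSq
      rw [cos_add_two_pi, sin_add_two_pi]
    have h02 : distSq a b p q (-z) < distSq a b p q τ₂ := by
      have e1 : distSq a b p q (-τ₂) < distSq a b p q τ₂ := by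
        unfold distSq
        rw [cos_neg, sin_neg]
        have := mul_pos hQ (sin_cos_pos m2).1
        nlinarith
      refine lt_of_le_of_lt ?_ e1
      rcases le_total τ₂ z with h | h
      · exact h01.monotoneOn ⟨le_rfl, by linarith⟩ ⟨by linarith, by linarith⟩ (by linarith)
      · have e2 : distSq a b p q (-τ₂ + 2 * π) = distSq a b p q (-τ₂) := by
          unfold distSq
          rw [cos_add_two_pi, sin_add_two_pi]
        rw [← hper, ← e2]
        exact h34.antitoneOn ⟨by linarith, by linarith⟩ ⟨by linarith, by linarith⟩ (by linarith)
    have h13 : distSq a b p q τ₁ < distSq a b p q (π / 2 + w) := by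
      have e1 : distSq a b p q τ₁ < distSq a b p q (π - τ₁) := by
        unfold distSq
        rw [cos_pi_sub, sin_pi_sub]
        have := mul_pos hP (sin_cos_pos m1).2
        nlinarith
      refine lt_of_lt_of_le e1 ?_
      rcases le_total (π - τ₁) (π / 2 + w) with h | h
      · exact h23.monotoneOn ⟨by linarith, by linarith⟩ ⟨by linarith, by linarith⟩ h
      · exact h34.antitoneOn ⟨by linarith, by linarith⟩ ⟨by linarith, by linarith⟩ h
    rw [ncard_level_eq_four_iff (continuous_distSq a b p q) (by linarith) l12 (by linarith)
      (by linarith) h01 h12 h23 h34 h02 (hper ▸ h02) h13]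
    have zeros : ∀ t ∈ Ioo 0 (π / 2), critFun (a ^ 2 - b ^ 2) (a * p) (b * q) t = 0 →
        t = τ₁ ∨ t = τ₂ := by
      intro t ht h0
      by_contra! hne
      rcases lt_or_gt_of_ne hne.1 with h | h
      · exact (s1 t ⟨ht.1, h⟩).ne' h0
      rcases lt_or_gt_of_ne hne.2 with h' | h'
      · exact (s2 t ⟨h, h'⟩).ne h0
      · exact (s3 t ⟨h', ht.2⟩).ne' h0
    constructor
    · rintro ⟨hv2, hv1⟩
      refine ⟨⟨τ₂, m2, k2, d2, hv2⟩, ?_⟩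
      rintro ⟨t, ht, h0, hd, hv⟩
      rcases zeros t ht h0 with rfl | rfl <;> linarith
    · rintro ⟨⟨t, ht, h0, hd, hv⟩, hno⟩
      constructor
      · rcases zeros t ht h0 with rfl | rfl
        · linarith
        · exact hv
      · by_contra! h
        exact hno ⟨τ₁, m1, k1, d1, h⟩
  · have m11 := hτ.1
    have m12 := hτ.2
    have h01 : StrictMonoOn (distSq a b p q) (Icc (-z) τ) := by
      refine strictMonoOn_distSq fun t ht => ?_
      rcases le_or_gt t 0 with h | h
      · exact sz t ⟨ht.1, h⟩
      · have ht' : t ∈ Ioo 0 (π / 2) := ⟨h, ht.2.trans m12⟩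
        exact hpos t ht' (hτ1 t ht' ht.2.ne)
    have h23 : StrictMonoOn (distSq a b p q) (Icc τ (π / 2 + w)) := by
      refine strictMonoOn_distSq fun t ht => ?_
      rcases lt_or_ge t (π / 2) with h | h
      · have ht' : t ∈ Ioo 0 (π / 2) := ⟨m11.trans ht.1, h⟩
        exact hpos t ht' (hτ1 t ht' ht.1.ne')
      · exact sw t ⟨h, ht.2⟩
    have h03 : StrictMonoOn (distSq a b p q) (Icc (-z) (π / 2 + w)) := by
      rw [← Icc_union_Icc_eq_Icc (b := τ) (by linarith) (by linarith)]
      exact h01.union h23 (isGreatest_Icc (by linarith)) (isLeast_Icc (by linarith))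
    refine iff_of_false (ncard_level_ne_four h03 h34) ?_
    rintro ⟨⟨t, ht, h0, hd, -⟩, -⟩
    by_cases h : t = τ
    · subst h
      exact hd.ne' (hτ2 h0)
    · exact (hτ1 t ht h).ne' h0

/-- Intersections of a circle with the ellipse, counted by eccentric angle. -/
lemma ncard_sphere_inter_Cset {a b r : ℝ} (ha : 0 < a) (hb : 0 < b) (hr : 0 ≤ r) (p q θ : ℝ) :
    (sphere (!₂[p, -q] : E2) r ∩ Cset a b).ncard =
      {t ∈ Ico θ (θ + 2 * π) | distSq a b p q t = r ^ 2}.ncard := by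
  have hinj : InjOn (fun t : ℝ => (!₂[a * cos t, b * sin t] : E2))
      {t ∈ Ico θ (θ + 2 * π) | distSq a b p q t = r ^ 2} := by
    rintro s ⟨hs, -⟩ t ⟨ht, -⟩ hst
    have h0 : a * cos s = a * cos t := by simpa using congrArg (fun x : E2 => x 0) hst
    have h1 : b * sin s = b * sin t := by simpa using congrArg (fun x : E2 => x 1) hst
    have := Real.Angle.cos_sin_inj (mul_left_cancel₀ ha.ne' h0) (mul_left_cancel₀ hb.ne' h1)
    rw [Real.Angle.angle_eq_iff_two_pi_dvd_sub] at this
    obtain ⟨k, hk⟩ := this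
    have hpi := pi_pos
    have k1 : (k : ℝ) < 1 := by nlinarith [hs.1, hs.2, ht.1, ht.2]
    have k2 : (-1 : ℝ) < k := by nlinarith [hs.1, hs.2, ht.1, ht.2]
    have k0 : k = 0 := by
      have : k < 1 := by exact_mod_cast k1
      have : -1 < k := by exact_mod_cast k2
      omega
    rw [k0] at hk
    simp at hk
    linarith
  rw [← hinj.ncard_image]
  congr 1
  ext x
  simp only [mem_inter_iff, mem_sphere, Cset, mem_image, EuclideanSpace.dist_eq, Fin.sum_univ_two]
  constructor
  · rintro ⟨hx, hC⟩
    have hC' : x 0 ^ 2 / a ^ 2 + x 1 ^ 2 / b ^ 2 = 1 := hC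
    obtain ⟨t₀, hc, hs⟩ : ∃ t, cos t = x 0 / a ∧ sin t = x 1 / b := by
      have hn : ‖(⟨x 0 / a, x 1 / b⟩ : ℂ)‖ = 1 := by
        rw [Complex.norm_def, Complex.normSq_mk, Real.sqrt_eq_one, ← hC']
        ring
      have hne : (⟨x 0 / a, x 1 / b⟩ : ℂ) ≠ 0 := by
        rw [← norm_ne_zero_iff, hn]
        norm_num
      exact ⟨Complex.arg ⟨x 0 / a, x 1 / b⟩, by rw [Complex.cos_arg hne, hn, div_one],
        by rw [Complex.sin_arg, hn, div_one]⟩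
    have hper : ∀ n : ℤ, cos (t₀ - n • (2 * π)) = cos t₀ ∧ sin (t₀ - n • (2 * π)) = sin t₀ :=
      fun n => by
        simp only [zsmul_eq_mul]
        exact ⟨cos_sub_int_mul_two_pi t₀ n, sin_sub_int_mul_two_pi t₀ n⟩
    have hmem := toIcoMod_mem_Ico two_pi_pos θ t₀
    obtain ⟨ec, es⟩ := hper (toIcoDiv two_pi_pos θ t₀)
    rw [self_sub_toIcoDiv_zsmul, hc] at ec
    rw [self_sub_toIcoDiv_zsmul, hs] at es
    refine ⟨toIcoMod two_pi_pos θ t₀, ⟨hmem, ?_⟩, ?_⟩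
    · rw [← hx, Real.sq_sqrt (by positivity)]
      unfold distSq
      rw [ec, es]
      simp only [Real.dist_eq, sq_abs]
      simp
      field_simp
    · ext i
      fin_cases i
      · simp [ec]
        field_simp
      · simp [es]
        field_simp
  · rintro ⟨t, ⟨-, ht⟩, rfl⟩
    constructor
    · rw [← Real.sqrt_sq hr, ← ht]
      simp only [Real.dist_eq, sq_abs]
      simp [distSq]
    · simp only [mem_ofPred_eq]
      simp
      field_simp
      linarith [sin_sq_add_cos_sq t]

end Counting

section Normals

/-- Squared speed of the parametrization of the ellipse by the eccentric angle. -/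
def speedSq (a b t : ℝ) : ℝ := b ^ 2 * cos t ^ 2 + a ^ 2 * sin t ^ 2

/-- The point at parameter `x.2` on the inner normal of the ellipse at eccentric angle `x.1`,
reflected in the major axis. -/
def normalMap (a b : ℝ) (x : ℝ × ℝ) : ℝ × ℝ :=
  (cos x.1 * (a - b * x.2), sin x.1 * (a * x.2 - b))

/-- Normal coordinates of the centers closer than `r` to the ellipse at a local minimum of the
distance in the quadrant under consideration. -/
def minDom (a b r : ℝ) : Set (ℝ × ℝ) :=
  {x | (x.1 ∈ Ioo 0 (π / 2) ∧ b / a < x.2) ∧ a * b * x.2 < speedSq a b x.1 ∧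
    x.2 ^ 2 * speedSq a b x.1 < r ^ 2}

/-- Normal coordinates of the centers at distance at most `r` from the ellipse at a local maximum
of the distance in the quadrant under consideration. -/
def maxDom (a b r : ℝ) : Set (ℝ × ℝ) :=
  {x | (x.1 ∈ Ioo 0 (π / 2) ∧ b / a < x.2) ∧ speedSq a b x.1 < a * b * x.2 ∧
    x.2 ^ 2 * speedSq a b x.1 ≤ r ^ 2}

lemma continuous_speedSq (a b : ℝ) : Continuous (speedSq a b) := by
  unfold speedSq
  fun_prop

lemma sq_le_speedSq {a b : ℝ} (hb : 0 < b) (hba : b < a) (t : ℝ) : b ^ 2 ≤ speedSq a b t := by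
  have h := sin_sq_add_cos_sq t
  have : speedSq a b t = b ^ 2 + (a ^ 2 - b ^ 2) * sin t ^ 2 := by
    unfold speedSq
    linear_combination b ^ 2 * h
  have : 0 ≤ a ^ 2 - b ^ 2 := by nlinarith
  nlinarith [sq_nonneg (sin t)]

lemma speedSq_pos {a b : ℝ} (hb : 0 < b) (hba : b < a) (t : ℝ) : 0 < speedSq a b t :=
  (pow_pos hb 2).trans_le (sq_le_speedSq hb hba t)

lemma param_lt_one {a b r l t : ℝ} (hb : 0 < b) (hba : b < a) (hr : 0 < r) (hrb : r < b)
    (h : l ^ 2 * speedSq a b t ≤ r ^ 2) : l < 1 := by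
  by_contra! hl
  have h1 : b ^ 2 ≤ l ^ 2 * speedSq a b t := by
    have := sq_le_speedSq hb hba t
    have : 1 ≤ l ^ 2 := one_le_pow₀ hl
    nlinarith [pow_pos hb 2]
  nlinarith

lemma normalMap_pos {a b t l : ℝ} (hb : 0 < b) (hba : b < a) (ht : t ∈ Ioo 0 (π / 2))
    (h1 : b / a < l) (h2 : l < 1) :
    0 < cos t * (a - b * l) ∧ 0 < sin t * (a * l - b) := by
  obtain ⟨s1, c1⟩ := sin_cos_pos ht
  have ha := hb.trans hba
  rw [div_lt_iff₀ ha] at h1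
  exact ⟨mul_pos c1 (by nlinarith), mul_pos s1 (by linarith)⟩

lemma critFun_normalMap (a b l : ℝ) {t : ℝ} (ht : t ∈ Ioo 0 (π / 2)) :
    critFun (a ^ 2 - b ^ 2) (a * (cos t * (a - b * l))) (b * (sin t * (a * l - b))) t = 0 := by
  obtain ⟨s1, c1⟩ := sin_cos_pos ht
  unfold critFun
  field_simp
  ring

lemma critDeriv_normalMap (a b l : ℝ) {t : ℝ} (ht : t ∈ Ioo 0 (π / 2)) :
    critDeriv (a * (cos t * (a - b * l))) (b * (sin t * (a * l - b))) t =
      (speedSq a b t - a * b * l) / (sin t * cos t) := by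
  obtain ⟨s1, c1⟩ := sin_cos_pos ht
  unfold critDeriv speedSq
  field_simp
  linear_combination (-a * b * l) * sin_sq_add_cos_sq t

lemma distSq_normalMap (a b t l : ℝ) :
    distSq a b (cos t * (a - b * l)) (sin t * (a * l - b)) t = l ^ 2 * speedSq a b t := by
  unfold distSq speedSq
  ring

lemma exists_normal_param {a b p q t : ℝ} (hb : 0 < b) (hba : b < a) (hq : 0 < q)
    (ht : t ∈ Ioo 0 (π / 2)) (h0 : critFun (a ^ 2 - b ^ 2) (a * p) (b * q) t = 0) :
    ∃ l, b / a < l ∧ p = cos t * (a - b * l) ∧ q = sin t * (a * l - b) := by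
  obtain ⟨s1, c1⟩ := sin_cos_pos ht
  have ha := hb.trans hba
  unfold critFun at h0
  have hl : q = sin t * (a * ((a - p / cos t) / b) - b) := by
    field_simp at h0 ⊢
    linarith
  refine ⟨(a - p / cos t) / b, ?_, ?_, hl⟩
  · rw [div_lt_iff₀ ha]
    rw [hl] at hq
    have := pos_of_mul_pos_right hq s1.le
    linarith
  · field_simp
    ring

lemma image_minDom_iff {a b r : ℝ} (hb : 0 < b) (hba : b < a) (hr : 0 < r) (hrb : r < b)
    (z : ℝ × ℝ) :
    z ∈ normalMap a b '' minDom a b r ↔ (0 < z.1 ∧ 0 < z.2) ∧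
      ∃ t ∈ Ioo 0 (π / 2), critFun (a ^ 2 - b ^ 2) (a * z.1) (b * z.2) t = 0 ∧
        0 < critDeriv (a * z.1) (b * z.2) t ∧ distSq a b z.1 z.2 t < r ^ 2 := by
  constructor
  · rintro ⟨⟨t, l⟩, ⟨⟨ht, hl⟩, hg, hd⟩, rfl⟩
    obtain ⟨s1, c1⟩ := sin_cos_pos ht
    refine ⟨normalMap_pos hb hba ht hl (param_lt_one hb hba hr hrb hd.le), t, ht,
      critFun_normalMap a b l ht, ?_, ?_⟩
    · simp only [normalMap]
      rw [critDeriv_normalMap a b l ht]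
      exact div_pos (sub_pos.2 hg) (by positivity)
    · simp only [normalMap]
      rw [distSq_normalMap]
      exact hd
  · obtain ⟨p, q⟩ := z
    rintro ⟨⟨hp, hq⟩, t, ht, h0, hd, hv⟩
    obtain ⟨l, hl, rfl, rfl⟩ := exists_normal_param hb hba hq ht h0
    obtain ⟨s1, c1⟩ := sin_cos_pos ht
    simp only at hd hv
    rw [critDeriv_normalMap a b l ht] at hd
    rw [distSq_normalMap] at hv
    refine ⟨(t, l), ⟨⟨ht, hl⟩, ?_, hv⟩, rfl⟩
    exact sub_pos.1 ((div_pos_iff_of_pos_right (mul_pos s1 c1)).1 hd)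

lemma image_maxDom_iff {a b r : ℝ} (hb : 0 < b) (hba : b < a) (hr : 0 < r) (hrb : r < b)
    (z : ℝ × ℝ) :
    z ∈ normalMap a b '' maxDom a b r ↔ (0 < z.1 ∧ 0 < z.2) ∧
      ∃ t ∈ Ioo 0 (π / 2), critFun (a ^ 2 - b ^ 2) (a * z.1) (b * z.2) t = 0 ∧
        critDeriv (a * z.1) (b * z.2) t < 0 ∧ distSq a b z.1 z.2 t ≤ r ^ 2 := by
  constructor
  · rintro ⟨⟨t, l⟩, ⟨⟨ht, hl⟩, hg, hd⟩, rfl⟩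
    obtain ⟨s1, c1⟩ := sin_cos_pos ht
    refine ⟨normalMap_pos hb hba ht hl (param_lt_one hb hba hr hrb hd), t, ht,
      critFun_normalMap a b l ht, ?_, ?_⟩
    · simp only [normalMap]
      rw [critDeriv_normalMap a b l ht]
      exact div_neg_of_neg_of_pos (sub_neg.2 hg) (by positivity)
    · simp only [normalMap]
      rw [distSq_normalMap]
      exact hd
  · obtain ⟨p, q⟩ := z
    rintro ⟨⟨hp, hq⟩, t, ht, h0, hd, hv⟩
    obtain ⟨l, hl, rfl, rfl⟩ := exists_normal_param hb hba hq ht h0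
    obtain ⟨s1, c1⟩ := sin_cos_pos ht
    simp only at hd hv
    rw [critDeriv_normalMap a b l ht] at hd
    rw [distSq_normalMap] at hv
    refine ⟨(t, l), ⟨⟨ht, hl⟩, ?_, hv⟩, rfl⟩
    by_contra! h
    exact absurd hd (not_lt.2 (div_nonneg (sub_nonneg.2 h) (mul_pos s1 c1).le))

lemma image_maxDom_subset {a b r : ℝ} (hb : 0 < b) (hba : b < a) (hr : 0 < r) (hrb : r < b) :
    normalMap a b '' maxDom a b r ⊆ normalMap a b '' minDom a b r := by
  intro z hz
  rw [image_maxDom_iff hb hba hr hrb] at hz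
  obtain ⟨hpos, t, ht, h0, hd, hv⟩ := hz
  obtain ⟨u, hu, hu0, hud, huv⟩ :=
    exists_lower_min (mul_pos (hb.trans hba) hpos.1) (mul_pos hb hpos.2) ht h0 hd
  exact (image_minDom_iff hb hba hr hrb z).2 ⟨hpos, u, hu, hu0, hud, huv.trans_le hv⟩

/-- The centers in an open quadrant whose circle of radius `r` meets the ellipse four times. -/
lemma quadrant_eq {a b r : ℝ} (hb : 0 < b) (hba : b < a) (hr : 0 < r) (hrb : r < b) :
    {z : ℝ × ℝ | (0 < z.1 ∧ 0 < z.2) ∧ (sphere (!₂[z.1, -z.2] : E2) r ∩ Cset a b).ncard = 4} =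
      normalMap a b '' minDom a b r \ normalMap a b '' maxDom a b r := by
  ext z
  rw [mem_sdiff, image_minDom_iff hb hba hr hrb, image_maxDom_iff hb hba hr hrb, mem_ofPred_eq]
  by_cases hz : 0 < z.1 ∧ 0 < z.2
  · obtain ⟨θ, hθ⟩ := ncard_distSq_level_eq_four_iff (r ^ 2) hb hba hz.1 hz.2
    rw [ncard_sphere_inter_Cset (hb.trans hba) hb hr.le _ _ θ, hθ]
    simp only [hz, and_self, true_and]
  · simp only [hz, false_and, not_false_eq_true, and_true]

lemma eq_of_normalMap_eq {a b : ℝ} (hb : 0 < b) {x y : ℝ × ℝ} (hx : x.1 ∈ Ioo 0 (π / 2))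
    (h : normalMap a b x = normalMap a b y) (h1 : x.1 = y.1) : x = y := by
  obtain ⟨s1, c1⟩ := sin_cos_pos hx
  have := congrArg Prod.fst h
  simp only [normalMap] at this
  rw [← h1] at this
  have := mul_left_cancel₀ c1.ne' this
  exact Prod.ext h1 (mul_left_cancel₀ hb.ne' (by linarith))

lemma injOn_normalMap_minDom {a b r : ℝ} (hb : 0 < b) (hba : b < a) (hr : 0 < r) (hrb : r < b) :
    InjOn (normalMap a b) (minDom a b r) := by
  have key : ∀ x ∈ minDom a b r, ∀ y ∈ minDom a b r, normalMap a b x = normalMap a b y →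
      ¬ x.1 < y.1 := by
    rintro ⟨t, l⟩ ⟨⟨ht, hl⟩, hg, hd⟩ ⟨u, m⟩ ⟨⟨hu, hm⟩, -, -⟩ hxy hlt
    obtain ⟨s1, c1⟩ := sin_cos_pos ht
    obtain ⟨hp, hq⟩ := normalMap_pos hb hba ht hl (param_lt_one hb hba hr hrb hd.le)
    have e1 := critFun_normalMap a b l ht
    have e2 := critFun_normalMap a b m hu
    simp only [normalMap, Prod.mk.injEq] at hxy
    rw [← hxy.1, ← hxy.2] at e2
    have h := (strictConvexOn_critFun (a ^ 2 - b ^ 2) (mul_pos (hb.trans hba) hp)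
      (mul_pos hb hq)).lt_slope_of_hasDerivAt ht hu hlt (hasDerivAt_critFun _ _ _ ht)
    rw [slope_def_field, e1, e2, sub_zero, zero_div, critDeriv_normalMap a b l ht] at h
    exact absurd h (not_lt.2 (div_nonneg (sub_nonneg.2 hg.le) (mul_pos s1 c1).le))
  intro x hx y hy hxy
  exact eq_of_normalMap_eq hb hx.1.1 hxy
    (le_antisymm (not_lt.1 (key y hy x hx hxy.symm)) (not_lt.1 (key x hx y hy hxy)))

lemma injOn_normalMap_maxDom {a b r : ℝ} (hb : 0 < b) (hba : b < a) (hr : 0 < r) (hrb : r < b) :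
    InjOn (normalMap a b) (maxDom a b r) := by
  have key : ∀ x ∈ maxDom a b r, ∀ y ∈ maxDom a b r, normalMap a b x = normalMap a b y →
      ¬ y.1 < x.1 := by
    rintro ⟨t, l⟩ ⟨⟨ht, hl⟩, hg, hd⟩ ⟨u, m⟩ ⟨⟨hu, hm⟩, -, -⟩ hxy hlt
    obtain ⟨s1, c1⟩ := sin_cos_pos ht
    obtain ⟨hp, hq⟩ := normalMap_pos hb hba ht hl (param_lt_one hb hba hr hrb hd)
    have e1 := critFun_normalMap a b l ht
    have e2 := critFun_normalMap a b m hu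
    simp only [normalMap, Prod.mk.injEq] at hxy
    rw [← hxy.1, ← hxy.2] at e2
    have h := (strictConvexOn_critFun (a ^ 2 - b ^ 2) (mul_pos (hb.trans hba) hp)
      (mul_pos hb hq)).slope_lt_of_hasDerivAt hu ht hlt (hasDerivAt_critFun _ _ _ ht)
    rw [slope_def_field, e1, e2, sub_zero, zero_div, critDeriv_normalMap a b l ht] at h
    exact absurd h (not_lt.2 (div_neg_of_neg_of_pos (sub_neg.2 hg) (mul_pos s1 c1)).le)
  intro x hx y hy hxy
  exact eq_of_normalMap_eq hb hx.1.1 hxy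
    (le_antisymm (not_lt.1 (key x hx y hy hxy)) (not_lt.1 (key y hy x hx hxy.symm)))

/-- The derivative of `normalMap`. -/
def normalMapDeriv (a b : ℝ) (x : ℝ × ℝ) : ℝ × ℝ →L[ℝ] ℝ × ℝ :=
  (Matrix.toLin (.finTwoProd ℝ) (.finTwoProd ℝ)
    !![-sin x.1 * (a - b * x.2), -b * cos x.1;
      cos x.1 * (a * x.2 - b), a * sin x.1]).toContinuousLinearMap

lemma hasFDerivAt_normalMap (a b : ℝ) (x : ℝ × ℝ) :
    HasFDerivAt (normalMap a b) (normalMapDeriv a b x) x := by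
  unfold normalMapDeriv
  rw [Matrix.toLin_finTwoProd_toContinuousLinearMap]
  have hc := (hasDerivAt_cos x.1).comp_hasFDerivAt x (hasFDerivAt_fst (𝕜 := ℝ))
  have hs := (hasDerivAt_sin x.1).comp_hasFDerivAt x (hasFDerivAt_fst (𝕜 := ℝ))
  have h2 : HasFDerivAt (fun y : ℝ × ℝ => y.2) (ContinuousLinearMap.snd ℝ ℝ ℝ) x :=
    hasFDerivAt_snd
  refine ((hc.mul ((h2.const_mul b).const_sub a)).prodMk
    (hs.mul ((h2.const_mul a).sub_const b))).congr_fderiv ?_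
  ext <;> simp <;> ring

lemma det_normalMapDeriv (a b : ℝ) (x : ℝ × ℝ) :
    (normalMapDeriv a b x).det = a * b * x.2 - speedSq a b x.1 := by
  unfold normalMapDeriv speedSq
  simp only [LinearMap.det_toContinuousLinearMap, LinearMap.det_toLin, Matrix.det_fin_two_of]
  linear_combination (a * b * x.2) * sin_sq_add_cos_sq x.1

lemma measurableSet_minDom (a b r : ℝ) : MeasurableSet (minDom a b r) := by
  have hS : Measurable fun x : ℝ × ℝ => speedSq a b x.1 :=
    ((continuous_speedSq a b).comp continuous_fst).measurable
  exact ((measurable_fst measurableSet_Ioo).inter (measurableSet_lt measurable_const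
    measurable_snd)).inter ((measurableSet_lt (measurable_snd.const_mul _) hS).inter
      (measurableSet_lt ((measurable_snd.pow_const 2).mul hS) measurable_const))

lemma measurableSet_maxDom (a b r : ℝ) : MeasurableSet (maxDom a b r) := by
  have hS : Measurable fun x : ℝ × ℝ => speedSq a b x.1 :=
    ((continuous_speedSq a b).comp continuous_fst).measurable
  exact ((measurable_fst measurableSet_Ioo).inter (measurableSet_lt measurable_const
    measurable_snd)).inter ((measurableSet_lt hS (measurable_snd.const_mul _)).inter
      (measurableSet_le ((measurable_snd.pow_const 2).mul hS) measurable_const))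

lemma integrableOn_jacobian {a b r : ℝ} (hb : 0 < b) (hba : b < a) (hr : 0 < r) (hrb : r < b) :
    IntegrableOn (fun x : ℝ × ℝ => speedSq a b x.1 - a * b * x.2)
      (minDom a b r ∪ maxDom a b r) := by
  have hcont : Continuous fun x : ℝ × ℝ => speedSq a b x.1 - a * b * x.2 :=
    ((continuous_speedSq a b).comp continuous_fst).sub (by fun_prop)
  have hK : IntegrableOn (fun x : ℝ × ℝ => speedSq a b x.1 - a * b * x.2)
      (Icc 0 (π / 2) ×ˢ Icc 0 1) :=
    hcont.continuousOn.integrableOn_compact (isCompact_Icc.prod isCompact_Icc)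
  refine hK.mono_set ?_
  have h0 : 0 < b / a := div_pos hb (hb.trans hba)
  rintro ⟨t, l⟩ (⟨⟨ht, hl⟩, -, h⟩ | ⟨⟨ht, hl⟩, -, h⟩)
  · exact ⟨⟨ht.1.le, ht.2.le⟩, ⟨(h0.trans hl).le, (param_lt_one hb hba hr hrb h.le).le⟩⟩
  · exact ⟨⟨ht.1.le, ht.2.le⟩, ⟨(h0.trans hl).le, (param_lt_one hb hba hr hrb h).le⟩⟩

lemma volume_quadrant {a b r : ℝ} (hb : 0 < b) (hba : b < a) (hr : 0 < r) (hrb : r < b) :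
    volume {z : ℝ × ℝ | (0 < z.1 ∧ 0 < z.2) ∧
        (sphere (!₂[z.1, -z.2] : E2) r ∩ Cset a b).ncard = 4} =
      ENNReal.ofReal (∫ x in minDom a b r ∪ maxDom a b r, speedSq a b x.1 - a * b * x.2) := by
  have hint := integrableOn_jacobian hb hba hr hrb
  have hI1 := hint.mono_set subset_union_left
  have hI2 := hint.mono_set subset_union_right
  have hm1 := measurableSet_minDom a b r
  have hm2 := measurableSet_maxDom a b r
  have hd : ∀ s : Set (ℝ × ℝ), ∀ x ∈ s,
      HasFDerivWithinAt (normalMap a b) (normalMapDeriv a b x) s x :=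
    fun s x _ => (hasFDerivAt_normalMap a b x).hasFDerivWithinAt
  have v1 : volume (normalMap a b '' minDom a b r) =
      ENNReal.ofReal (∫ x in minDom a b r, speedSq a b x.1 - a * b * x.2) := by
    rw [← lintegral_abs_det_fderiv_eq_addHaar_image volume hm1 (hd _)
      (injOn_normalMap_minDom hb hba hr hrb), ofReal_integral_eq_lintegral_ofReal hI1
      (ae_restrict_of_forall_mem hm1 fun x hx => sub_nonneg.2 hx.2.1.le)]
    refine setLIntegral_congr_fun hm1 fun x hx => ?_
    rw [det_normalMapDeriv, abs_sub_comm, abs_of_pos (sub_pos.2 hx.2.1)]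
  have hI2' : IntegrableOn (fun x : ℝ × ℝ => -(speedSq a b x.1 - a * b * x.2)) (maxDom a b r) :=
    hI2.neg
  have v2 : volume (normalMap a b '' maxDom a b r) =
      ENNReal.ofReal (-∫ x in maxDom a b r, speedSq a b x.1 - a * b * x.2) := by
    rw [← lintegral_abs_det_fderiv_eq_addHaar_image volume hm2 (hd _)
      (injOn_normalMap_maxDom hb hba hr hrb), ← integral_neg,
      ofReal_integral_eq_lintegral_ofReal hI2'
      (ae_restrict_of_forall_mem hm2 fun x hx => neg_nonneg.2 (sub_neg.2 hx.2.1).le)]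
    refine setLIntegral_congr_fun hm2 fun x hx => ?_
    rw [det_normalMapDeriv, neg_sub, abs_of_pos (sub_pos.2 hx.2.1)]
  have hdisj : Disjoint (minDom a b r) (maxDom a b r) := by
    rw [Set.disjoint_left]
    intro x hx hy
    exact lt_asymm hx.2.1 hy.2.1
  rw [quadrant_eq hb hba hr hrb, measure_sdiff (image_maxDom_subset hb hba hr hrb)
    (measurable_image_of_fderivWithin hm2 (hd _)
      (injOn_normalMap_maxDom hb hba hr hrb)).nullMeasurableSet (by rw [v2]; simp), v1, v2,
    ← ENNReal.ofReal_sub, setIntegral_union hdisj hm2 hI1 hI2, sub_neg_eq_add]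
  rw [← integral_neg]
  exact setIntegral_nonneg hm2 fun x hx => neg_nonneg.2 (sub_neg.2 hx.2.1).le

end Normals

section Symmetry

lemma ncard_sphere_inter_involutive {f : E2 → E2} (hf : Function.Involutive f)
    (hd : ∀ x y, dist (f x) (f y) = dist x y) {C : Set E2} (hC : ∀ x, f x ∈ C ↔ x ∈ C) (x : E2)
    (r : ℝ) : (sphere (f x) r ∩ C).ncard = (sphere x r ∩ C).ncard := by
  rw [← hf.injective.injOn.ncard_image (s := sphere x r ∩ C)]
  congr 1
  ext y
  constructor
  · rintro ⟨hy, hyC⟩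
    refine ⟨f y, ⟨?_, (hC y).2 hyC⟩, hf y⟩
    rw [mem_sphere] at hy ⊢
    rw [← hd, hf y, hy]
  · rintro ⟨y, ⟨hy, hyC⟩, rfl⟩
    rw [mem_sphere] at hy
    exact ⟨by rw [mem_sphere, hd, hy], (hC y).2 hyC⟩

lemma ncard_sphere_neg_fst (a b r p q : ℝ) :
    (sphere (!₂[-p, q] : E2) r ∩ Cset a b).ncard =
      (sphere (!₂[p, q] : E2) r ∩ Cset a b).ncard := by
  have := ncard_sphere_inter_involutive (f := fun x : E2 => (!₂[-x 0, x 1] : E2))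
    (fun x => by ext i; fin_cases i <;> simp)
    (fun x y => by
      simp only [EuclideanSpace.dist_eq, Fin.sum_univ_two, Real.dist_eq, sq_abs]
      congr 1
      simp
      ring)
    (C := Cset a b) (fun x => by simp [Cset]) (!₂[p, q]) r
  simpa using this

lemma ncard_sphere_neg_snd (a b r p q : ℝ) :
    (sphere (!₂[p, -q] : E2) r ∩ Cset a b).ncard =
      (sphere (!₂[p, q] : E2) r ∩ Cset a b).ncard := by
  have := ncard_sphere_inter_involutive (f := fun x : E2 => (!₂[x 0, -x 1] : E2))
    (fun x => by ext i; fin_cases i <;> simp)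
    (fun x y => by
      simp only [EuclideanSpace.dist_eq, Fin.sum_univ_two, Real.dist_eq, sq_abs]
      congr 1
      simp
      ring)
    (C := Cset a b) (fun x => by simp [Cset]) (!₂[p, q]) r
  simpa using this

/-- A set mapped to itself by a measure preserving involution which changes the sign of a
function with negligible zero set has twice the measure of its part where the function is
positive. -/
lemma volume_eq_two_mul_of_symm {e : (ℝ × ℝ) ≃ᵐ (ℝ × ℝ)} (he : MeasurePreserving e)
    {g : ℝ × ℝ → ℝ} (hg : Measurable g) (hge : ∀ z, g (e z) = -g z)
    (h0 : volume {z : ℝ × ℝ | g z = 0} = 0) {T : Set (ℝ × ℝ)} (hT : ∀ z, e z ∈ T ↔ z ∈ T) :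
    volume T = 2 * volume (T ∩ {z | 0 < g z}) := by
  have hm : MeasurableSet {z : ℝ × ℝ | 0 < g z} := measurableSet_lt measurable_const hg
  rw [← measure_inter_add_sdiff T hm, two_mul]
  congr 1
  have hpre : T ∩ {z | g z < 0} = e ⁻¹' (T ∩ {z | 0 < g z}) := by
    ext z
    simp only [mem_inter_iff, mem_ofPred_eq, mem_preimage, hT, hge, neg_pos]
  rw [← he.measure_preimage_equiv (T ∩ {z | 0 < g z}), ← hpre]
  refine le_antisymm ?_ (measure_mono fun z hz => ⟨hz.1, fun h => lt_asymm (show g z < 0 from hz.2) h⟩)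
  calc volume (T \ {z | 0 < g z}) ≤ volume ((T ∩ {z | g z < 0}) ∪ {z | g z = 0}) := by
        refine measure_mono fun z hz => ?_
        rcases lt_trichotomy (g z) 0 with h | h | h
        · exact Or.inl ⟨hz.1, h⟩
        · exact Or.inr h
        · exact absurd h hz.2
    _ ≤ volume (T ∩ {z | g z < 0}) + volume {z : ℝ × ℝ | g z = 0} := measure_union_le _ _
    _ = volume (T ∩ {z | g z < 0}) := by rw [h0, add_zero]

lemma volume_eq_four_mul_quadrant {T : Set (ℝ × ℝ)} (h1 : ∀ z : ℝ × ℝ, (-z.1, z.2) ∈ T ↔ z ∈ T)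
    (h2 : ∀ z : ℝ × ℝ, (z.1, -z.2) ∈ T ↔ z ∈ T) :
    volume T = 4 * volume (T ∩ {z | 0 < z.1} ∩ {z | 0 < z.2}) := by
  have hz1 : volume {z : ℝ × ℝ | z.1 = 0} = 0 := by
    have : {z : ℝ × ℝ | z.1 = 0} = {0} ×ˢ univ := by ext; simp
    rw [this, Measure.volume_eq_prod, Measure.prod_prod]
    simp
  have hz2 : volume {z : ℝ × ℝ | z.2 = 0} = 0 := by
    have : {z : ℝ × ℝ | z.2 = 0} = univ ×ˢ {0} := by ext; simp
    rw [this, Measure.volume_eq_prod, Measure.prod_prod]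
    simp
  have e1 := volume_eq_two_mul_of_symm
    (e := (MeasurableEquiv.neg ℝ).prodCongr (MeasurableEquiv.refl ℝ))
    ((Measure.measurePreserving_neg (volume : Measure ℝ)).prod (MeasurePreserving.id volume))
    measurable_fst (fun _ => rfl) hz1 h1
  have e2 := volume_eq_two_mul_of_symm
    (e := (MeasurableEquiv.refl ℝ).prodCongr (MeasurableEquiv.neg ℝ))
    ((MeasurePreserving.id volume).prod (Measure.measurePreserving_neg (volume : Measure ℝ)))
    measurable_snd (fun _ => rfl) hz2 (T := T ∩ {z | 0 < z.1})
    (fun z => and_congr_left' (h2 z))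
  rw [e1, e2, ← mul_assoc]
  norm_num

lemma volume_plane (S : Set E2) : volume S = volume {z : ℝ × ℝ | (!₂[z.1, z.2] : E2) ∈ S} := by
  have h := (volume_preserving_finTwoArrow ℝ).symm.trans
    (EuclideanSpace.volume_preserving_symm_measurableEquiv_toLp (Fin 2)).symm
  rw [← h.measure_preimage_equiv S]
  rfl

lemma volume_four_eq (a b r : ℝ) :
    volume {x : E2 | (sphere x r ∩ Cset a b).ncard = 4} =
      4 * volume {z : ℝ × ℝ | (0 < z.1 ∧ 0 < z.2) ∧
        (sphere (!₂[z.1, -z.2] : E2) r ∩ Cset a b).ncard = 4} := by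
  rw [volume_plane, volume_eq_four_mul_quadrant]
  · congr 2
    ext z
    simp only [mem_inter_iff, mem_ofPred_eq, ncard_sphere_neg_snd]
    tauto
  · intro z
    simp only [mem_ofPred_eq, ncard_sphere_neg_fst]
  · intro z
    simp only [mem_ofPred_eq, ncard_sphere_neg_snd]

end Symmetry

section Evaluation

/-- Eccentric angle of the point of the ellipse whose inner normal meets the major axis at
distance `r`. -/
def crossAng (a b r : ℝ) : ℝ := arctan (√(r ^ 2 * a ^ 2 - b ^ 4) / (a * √(b ^ 2 - r ^ 2)))

/-- Integral of the Jacobian of `normalMap` along a normal. -/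
def sliceIntegral (a b r t : ℝ) : ℝ :=
  speedSq a b t * (r / √(speedSq a b t) - b / a) -
    a * b / 2 * ((r / √(speedSq a b t)) ^ 2 - (b / a) ^ 2)

lemma crossAng_radicands {a b r : ℝ} (hb : 0 < b) (hba : b < a) (hr1 : b ^ 2 / a < r)
    (hr2 : r < b) : 0 < r ∧ 0 < r ^ 2 * a ^ 2 - b ^ 4 ∧ 0 < b ^ 2 - r ^ 2 := by
  have ha := hb.trans hba
  have hr : 0 < r := lt_trans (by positivity) hr1
  rw [div_lt_iff₀ ha] at hr1
  have hb2 := pow_pos hb 2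
  exact ⟨hr, by nlinarith, by nlinarith⟩

lemma lt_crossAng_iff {a b r t : ℝ} (hb : 0 < b) (hba : b < a) (hr1 : b ^ 2 / a < r)
    (hr2 : r < b) (ht : t ∈ Ioo 0 (π / 2)) :
    t < crossAng a b r ↔ b / a < r / √(speedSq a b t) := by
  obtain ⟨hr, hA, hB⟩ := crossAng_radicands hb hba hr1 hr2
  obtain ⟨s1, c1⟩ := sin_cos_pos ht
  have ha := hb.trans hba
  have hS := speedSq_pos hb hba t
  have hsB : 0 < √(b ^ 2 - r ^ 2) := sqrt_pos.2 hB
  have hsS : 0 < √(speedSq a b t) := sqrt_pos.2 hS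
  have e1 : t < crossAng a b r ↔ tan t < √(r ^ 2 * a ^ 2 - b ^ 4) / (a * √(b ^ 2 - r ^ 2)) := by
    rw [crossAng, ← arctan_strictMono.lt_iff_lt (a := tan t),
      arctan_tan (by linarith [ht.1, pi_pos]) ht.2]
  rw [e1, tan_eq_sin_div_cos, div_lt_div_iff₀ c1 (by positivity), div_lt_div_iff₀ ha hsS,
    ← pow_lt_pow_iff_left₀ (by positivity) (by positivity) two_ne_zero,
    ← pow_lt_pow_iff_left₀ (a := b * √(speedSq a b t)) (by positivity) (by positivity)
      two_ne_zero]
  simp only [mul_pow]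
  rw [sq_sqrt hA.le, sq_sqrt hB.le, sq_sqrt hS.le]
  have h := sin_sq_add_cos_sq t
  have key : r ^ 2 * a ^ 2 - b ^ 2 * speedSq a b t =
      (r ^ 2 * a ^ 2 - b ^ 4) * cos t ^ 2 - sin t ^ 2 * (a ^ 2 * (b ^ 2 - r ^ 2)) := by
    unfold speedSq
    linear_combination (-r ^ 2 * a ^ 2) * h
  constructor <;> intro h' <;> linarith

lemma integral_normal_slice {a b r : ℝ} (hb : 0 < b) (hba : b < a) (hr1 : b ^ 2 / a < r)
    (hr2 : r < b) (t : ℝ) :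
    ∫ l, (minDom a b r ∪ maxDom a b r).indicator
        (fun x : ℝ × ℝ => speedSq a b x.1 - a * b * x.2) (t, l) =
      (Ioo 0 (crossAng a b r)).indicator (sliceIntegral a b r) t := by
  obtain ⟨hr, -, -⟩ := crossAng_radicands hb hba hr1 hr2
  have ha := hb.trans hba
  by_cases ht : t ∈ Ioo 0 (π / 2)
  · have hS := speedSq_pos hb hba t
    have hsS : 0 < √(speedSq a b t) := sqrt_pos.2 hS
    have hae : (fun l => (minDom a b r ∪ maxDom a b r).indicator
        (fun x : ℝ × ℝ => speedSq a b x.1 - a * b * x.2) (t, l)) =ᵐ[volume]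
        (Ioo (b / a) (r / √(speedSq a b t))).indicator fun l => speedSq a b t - a * b * l := by
      have hfin : ({r / √(speedSq a b t)} : Set ℝ)ᶜ ∈ ae (volume : Measure ℝ) :=
        compl_mem_ae_iff.2 (by simp)
      filter_upwards [hfin] with l hl
      by_cases hl0 : b / a < l
      · have hlpos : 0 < l := (div_pos hb ha).trans hl0
        have hlt : l < r / √(speedSq a b t) ↔ l ^ 2 * speedSq a b t < r ^ 2 := by
          rw [lt_div_iff₀ hsS, ← pow_lt_pow_iff_left₀ (by positivity) hr.le two_ne_zero, mul_pow,
            sq_sqrt hS.le]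
        have hle : l ≤ r / √(speedSq a b t) ↔ l ^ 2 * speedSq a b t ≤ r ^ 2 := by
          rw [le_div_iff₀ hsS, ← pow_le_pow_iff_left₀ (by positivity) hr.le two_ne_zero, mul_pow,
            sq_sqrt hS.le]
        by_cases hlr : l < r / √(speedSq a b t)
        · rw [indicator_of_mem (show l ∈ Ioo (b / a) (r / √(speedSq a b t)) from ⟨hl0, hlr⟩)]
          rcases lt_trichotomy (speedSq a b t) (a * b * l) with h | h | h
          · exact indicator_of_mem (show (t, l) ∈ minDom a b r ∪ maxDom a b r from
              Or.inr ⟨⟨ht, hl0⟩, h, hle.1 hlr.le⟩) _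
          · refine Eq.trans ?_ (sub_eq_zero.2 h).symm
            exact indicator_apply_eq_zero.2 fun _ => sub_eq_zero.2 h
          · exact indicator_of_mem (show (t, l) ∈ minDom a b r ∪ maxDom a b r from
              Or.inl ⟨⟨ht, hl0⟩, h, hlt.1 hlr⟩) _
        · rw [indicator_of_notMem
            (show l ∉ Ioo (b / a) (r / √(speedSq a b t)) from fun h => hlr h.2)]
          refine indicator_of_notMem ?_ _
          rintro (⟨-, -, h⟩ | ⟨-, -, h⟩)
          · exact hlr (hlt.2 h)
          · exact hlr (lt_of_le_of_ne (hle.2 h) hl)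
      · rw [indicator_of_notMem
          (show l ∉ Ioo (b / a) (r / √(speedSq a b t)) from fun h => hl0 h.1)]
        refine indicator_of_notMem ?_ _
        rintro (⟨⟨-, h⟩, -⟩ | ⟨⟨-, h⟩, -⟩) <;> exact hl0 h
    rw [integral_congr_ae hae, integral_indicator measurableSet_Ioo]
    by_cases htc : t < crossAng a b r
    · rw [indicator_of_mem (show t ∈ Ioo _ _ from ⟨ht.1, htc⟩), ← integral_Ioc_eq_integral_Ioo,
        ← intervalIntegral.integral_of_le ((lt_crossAng_iff hb hba hr1 hr2 ht).1 htc).le,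
        intervalIntegral.integral_sub (by simp) (Continuous.intervalIntegrable (by fun_prop) _ _)]
      rw [intervalIntegral.integral_const, intervalIntegral.integral_const_mul, integral_id,
        smul_eq_mul]
      unfold sliceIntegral
      ring
    · rw [indicator_of_notMem (fun h => htc h.2), Ioo_eq_empty, setIntegral_empty]
      rwa [lt_crossAng_iff hb hba hr1 hr2 ht] at htc
  · rw [indicator_of_notMem fun h => ht ⟨h.1, h.2.trans (arctan_lt_pi_div_two _)⟩]
    refine (integral_congr_ae (Filter.Eventually.of_forall fun l => ?_)).trans
      (integral_zero ℝ ℝ)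
    refine indicator_of_notMem ?_ _
    rintro (⟨⟨h, -⟩, -⟩ | ⟨⟨h, -⟩, -⟩) <;> exact ht h

lemma crossAng_pos {a b r : ℝ} (hb : 0 < b) (hba : b < a) (hr1 : b ^ 2 / a < r)
    (hr2 : r < b) : 0 < crossAng a b r := by
  obtain ⟨hr, hA, hB⟩ := crossAng_radicands hb hba hr1 hr2
  have ha := hb.trans hba
  have := sqrt_pos.2 hA
  have := sqrt_pos.2 hB
  rw [crossAng, arctan_pos]
  positivity

lemma integral_jacobian {a b r : ℝ} (hb : 0 < b) (hba : b < a) (hr1 : b ^ 2 / a < r)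
    (hr2 : r < b) :
    ∫ x in minDom a b r ∪ maxDom a b r, speedSq a b x.1 - a * b * x.2 =
      ∫ t in (0 : ℝ)..crossAng a b r, sliceIntegral a b r t := by
  obtain ⟨hr, -, -⟩ := crossAng_radicands hb hba hr1 hr2
  have hU := (measurableSet_minDom a b r).union (measurableSet_maxDom a b r)
  have hint := (integrable_indicator_iff hU).2 (integrableOn_jacobian hb hba hr hr2)
  rw [← integral_indicator hU]
  rw [Measure.volume_eq_prod] at hint ⊢
  rw [integral_prod _ hint]
  simp_rw [integral_normal_slice hb hba hr1 hr2]
  rw [integral_indicator measurableSet_Ioo, ← integral_Ioc_eq_integral_Ioo,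
    ← intervalIntegral.integral_of_le (crossAng_pos hb hba hr1 hr2).le]

/-- Angle between the major axis and the normal to the ellipse at eccentric angle `t`. -/
def normalAng (a b t : ℝ) : ℝ := arctan (a / b * tan t)

lemma sin_cos_normalAng {a b t : ℝ} (hb : 0 < b) (hba : b < a) (hc : 0 < cos t) :
    sin (normalAng a b t) = a * sin t / √(speedSq a b t) ∧
      cos (normalAng a b t) = b * cos t / √(speedSq a b t) := by
  have ha := hb.trans hba
  have hS := speedSq_pos hb hba t
  have hsq : √(1 + (a / b * tan t) ^ 2) = √(speedSq a b t) / (b * cos t) := by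
    rw [← sqrt_sq (mul_pos hb hc).le, ← sqrt_div hS.le]
    congr 1
    unfold speedSq
    rw [tan_eq_sin_div_cos]
    field_simp
  have hsS : 0 < √(speedSq a b t) := sqrt_pos.2 hS
  unfold normalAng
  rw [sin_arctan, cos_arctan, hsq, tan_eq_sin_div_cos]
  constructor <;> field_simp

lemma ecc_sq {a b : ℝ} (hb : 0 < b) (hba : b < a) : ecc a b ^ 2 = (a ^ 2 - b ^ 2) / a ^ 2 := by
  rw [ecc, div_pow, sq_sqrt (by nlinarith)]

lemma sqrt_one_sub_ecc_sin {a b t : ℝ} (hb : 0 < b) (hba : b < a) (hc : 0 < cos t) :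
    √(1 - ecc a b ^ 2 * sin (normalAng a b t) ^ 2) = b / √(speedSq a b t) := by
  have ha := hb.trans hba
  have hS := speedSq_pos hb hba t
  rw [(sin_cos_normalAng hb hba hc).1, ecc_sq hb hba, ← sqrt_sq hb.le, ← sqrt_div (by positivity),
    sqrt_sq hb.le, div_pow, sq_sqrt hS.le]
  congr 1
  field_simp
  unfold speedSq
  linear_combination b ^ 2 * sin_sq_add_cos_sq t

lemma hasDerivAt_normalAng {a b t : ℝ} (hb : 0 < b) (hc : 0 < cos t) :
    HasDerivAt (normalAng a b) (a * b / speedSq a b t) t := by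
  refine (((hasDerivAt_tan hc.ne').const_mul (a / b)).arctan).congr_deriv ?_
  have : 0 < b ^ 2 * cos t ^ 2 + a ^ 2 * sin t ^ 2 := by positivity
  unfold speedSq
  rw [tan_eq_sin_div_cos]
  field_simp

lemma hasDerivAt_Einc (ε φ : ℝ) : HasDerivAt (Einc ε) (√(1 - ε ^ 2 * sin φ ^ 2)) φ := by
  have hc : Continuous fun θ : ℝ => √(1 - ε ^ 2 * sin θ ^ 2) := by fun_prop
  exact (hc.integral_hasStrictDerivAt 0 φ).hasDerivAt

/-- An antiderivative of `4 * sliceIntegral`. -/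
def slicePrimitive (a b r t : ℝ) : ℝ :=
  4 * r * (a * Einc (ecc a b) (normalAng a b t) -
      (a ^ 2 - b ^ 2) * (sin t * cos t / √(speedSq a b t))) -
    2 * r ^ 2 * normalAng a b t - 2 * a * b * t + 2 * (b / a) * (a ^ 2 - b ^ 2) * (sin t * cos t)

lemma hasDerivAt_slicePrimitive {a b r t : ℝ} (hb : 0 < b) (hba : b < a) (hc : 0 < cos t) :
    HasDerivAt (slicePrimitive a b r) (4 * sliceIntegral a b r t) t := by
  have ha := hb.trans hba
  have hS := speedSq_pos hb hba t
  have hsS : 0 < √(speedSq a b t) := sqrt_pos.2 hS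
  have hN := hasDerivAt_normalAng (a := a) hb hc
  have hE := (hasDerivAt_Einc (ecc a b) (normalAng a b t)).comp t hN
  rw [sqrt_one_sub_ecc_sin hb hba hc] at hE
  have hSd : HasDerivAt (speedSq a b) (2 * (a ^ 2 - b ^ 2) * (sin t * cos t)) t := by
    refine ((((hasDerivAt_cos t).pow 2).const_mul (b ^ 2)).add
      (((hasDerivAt_sin t).pow 2).const_mul (a ^ 2))).congr_deriv ?_
    push_cast
    ring
  have hsc := (hasDerivAt_sin t).mul (hasDerivAt_cos t)
  have hquot := hsc.div (hSd.sqrt hS.ne') hsS.ne'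
  have key := (((((hE.const_mul a).sub (hquot.const_mul (a ^ 2 - b ^ 2))).const_mul (4 * r)).sub
    (hN.const_mul (2 * r ^ 2))).sub ((hasDerivAt_id t).const_mul (2 * a * b))).add
    (hsc.const_mul (2 * (b / a) * (a ^ 2 - b ^ 2)))
  refine key.congr_deriv ?_
  have hss : √(speedSq a b t) ^ 2 = speedSq a b t := sq_sqrt hS.le
  simp only [Pi.mul_apply]
  unfold sliceIntegral
  have hdef : speedSq a b t = b ^ 2 * cos t ^ 2 + a ^ 2 * sin t ^ 2 := rfl
  have hcos := sin_sq_add_cos_sq t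
  have hC : cos t ^ 2 = (a ^ 2 - speedSq a b t) / (a ^ 2 - b ^ 2) := by
    rw [eq_div_iff (by nlinarith), hdef]
    linear_combination (a ^ 2) * hcos
  have hSn : sin t ^ 2 = (speedSq a b t - b ^ 2) / (a ^ 2 - b ^ 2) := by
    rw [eq_div_iff (by nlinarith), hdef]
    linear_combination (-b ^ 2) * hcos
  have hc0 : a ^ 2 - b ^ 2 ≠ 0 := by nlinarith
  rw [← hss] at hC hSn ⊢
  rw [sqrt_sq hsS.le]
  generalize √(speedSq a b t) = s at *
  have hd1 : cos t * cos t + sin t * -sin t = (a ^ 2 + b ^ 2 - 2 * s ^ 2) / (a ^ 2 - b ^ 2) := by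
    rw [show cos t * cos t + sin t * -sin t = cos t ^ 2 - sin t ^ 2 by ring, hC, hSn]
    ring
  have hd2 : sin t * cos t * (2 * (a ^ 2 - b ^ 2) * (sin t * cos t) / (2 * s)) =
      (s ^ 2 - b ^ 2) * (a ^ 2 - s ^ 2) / ((a ^ 2 - b ^ 2) * s) := by
    rw [show sin t * cos t * (2 * (a ^ 2 - b ^ 2) * (sin t * cos t) / (2 * s)) =
      sin t ^ 2 * cos t ^ 2 * (a ^ 2 - b ^ 2) / s by field_simp, hC, hSn]
    field_simp
  rw [hd1, hd2]
  field_simp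
  ring

lemma continuous_sliceIntegral {a b : ℝ} (hb : 0 < b) (hba : b < a) (r : ℝ) :
    Continuous (sliceIntegral a b r) := by
  have hS := continuous_speedSq a b
  have hd : Continuous fun t => r / √(speedSq a b t) :=
    continuous_const.div hS.sqrt fun t => (sqrt_pos.2 (speedSq_pos hb hba t)).ne'
  unfold sliceIntegral
  fun_prop

lemma integral_sliceIntegral {a b r : ℝ} (hb : 0 < b) (hba : b < a) (hr1 : b ^ 2 / a < r)
    (hr2 : r < b) :
    4 * ∫ t in (0 : ℝ)..crossAng a b r, sliceIntegral a b r t =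
      slicePrimitive a b r (crossAng a b r) - slicePrimitive a b r 0 := by
  rw [← intervalIntegral.integral_const_mul]
  refine intervalIntegral.integral_eq_sub_of_hasDerivAt (fun t ht => ?_)
    ((continuous_sliceIntegral hb hba r).const_mul 4 |>.intervalIntegrable _ _)
  rw [uIcc_of_le (crossAng_pos hb hba hr1 hr2).le] at ht
  exact hasDerivAt_slicePrimitive hb hba (cos_pos_of_mem_Ioo ⟨by linarith [ht.1, pi_pos],
    ht.2.trans_lt (arctan_lt_pi_div_two _)⟩)

lemma slicePrimitive_zero (a b r : ℝ) : slicePrimitive a b r 0 = 0 := by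
  simp [slicePrimitive, normalAng, Einc]

lemma normalAng_crossAng {a b : ℝ} (hb : 0 < b) (hba : b < a) (r : ℝ) :
    normalAng a b (crossAng a b r) = alphaAng a b r := by
  have ha := hb.trans hba
  rw [normalAng, crossAng, tan_arctan, alphaAng]
  congr 1
  field_simp

lemma speedSq_crossAng {a b r : ℝ} (hb : 0 < b) (hba : b < a) (hr1 : b ^ 2 / a < r)
    (hr2 : r < b) : √(speedSq a b (crossAng a b r)) = r * a / b := by
  obtain ⟨hr, hA, hB⟩ := crossAng_radicands hb hba hr1 hr2
  have ha := hb.trans hba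
  have hc : 0 < cos (crossAng a b r) := cos_arctan_pos _
  have ht : tan (crossAng a b r) = _ := tan_arctan _
  rw [tan_eq_sin_div_cos, div_eq_iff hc.ne'] at ht
  have ht2 := congrArg (· ^ 2) ht
  simp only [mul_pow, div_pow] at ht2
  rw [sq_sqrt hA.le, sq_sqrt hB.le] at ht2
  have h1 := sin_sq_add_cos_sq (crossAng a b r)
  rw [show r * a / b = √((r * a / b) ^ 2) from (sqrt_sq (by positivity)).symm]
  congr 1
  unfold speedSq
  field_simp at ht2 ⊢
  linear_combination ht2 + r ^ 2 * a ^ 2 * h1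

lemma slicePrimitive_crossAng {a b r : ℝ} (hb : 0 < b) (hba : b < a) (hr1 : b ^ 2 / a < r)
    (hr2 : r < b) :
    slicePrimitive a b r (crossAng a b r) = -Ffun a b r (alphaAng a b r) := by
  obtain ⟨hr, hA, hB⟩ := crossAng_radicands hb hba hr1 hr2
  have ha := hb.trans hba
  have hc : 0 < cos (crossAng a b r) := cos_arctan_pos _
  obtain ⟨hs1, hc1⟩ := sin_cos_normalAng hb hba hc
  have hsq := sqrt_one_sub_ecc_sin hb hba hc
  have hback : arctan (b / a * tan (alphaAng a b r)) = crossAng a b r := by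
    rw [alphaAng, tan_arctan, crossAng]
    congr 1
    field_simp
  rw [normalAng_crossAng hb hba, speedSq_crossAng hb hba hr1 hr2] at hs1 hc1 hsq
  unfold Ffun slicePrimitive
  rw [hback, hsq, sin_two_mul, hs1, hc1, normalAng_crossAng hb hba, ecc_sq hb hba,
    speedSq_crossAng hb hba hr1 hr2]
  field_simp
  ring

end Evaluation

/-- Case 2 of Lemma 1: for `b²/a < r < b`, the area of the set of centers `x` for which the
circle of radius `r` about `x` meets the ellipse in exactly four points is `−F(α)`. -/
theorem area_four_intersections_case2 (a b r : ℝ) (hb : 0 < b) (hba : b < a)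
    (hr1 : b^2 / a < r) (hr2 : r < b) :
    volume {x : E2 | (sphere x r ∩ Cset a b).ncard = 4} =
      ENNReal.ofReal (-(Ffun a b r (alphaAng a b r))) := by
  have hr := (crossAng_radicands hb hba hr1 hr2).1
  have h := integral_sliceIntegral hb hba hr1 hr2
  rw [slicePrimitive_zero, sub_zero, slicePrimitive_crossAng hb hba hr1 hr2] at h
  rw [volume_four_eq, volume_quadrant hb hba hr hr2, integral_jacobian hb hba hr1 hr2, ← h,
    ENNReal.ofReal_mul (by norm_num)]
  norm_num
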